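/- Let u be an optimal control for x₀ at time t₀, γ = γ^{t₀,x₀,u}, and τ₀ = τ^{t₀,x₀,u}. Then for every t ∈ (t₀, t₀+τ₀) and every (p_t, p_x) ∈ D⁺φ(t, γ(t)), one has −p_t + k(t, γ(t))|p_x| − 1 = 0. -/

import Mathlib

open MeasureTheory Filter Set Metric
open scoped Topology RealInnerProductSpace NNReal ENNReal

noncomputable section

abbrev Evec (d : ℕ) := EuclideanSpace ℝ (Fin d)

variable {d : ℕ}

/-- An admissible control: a measurable function with values in the closed unit ball. -/
def IsControl (u : ℝ → Evec d) : Prop :=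
  Measurable u ∧ ∀ t, ‖u t‖ ≤ 1

/-- `γ` is the (absolutely continuous) trajectory of the control system
`γ'(t) = k(t, γ(t)) u(t)` for a.e. `t ≥ t₀`, `γ(t₀) = x₀`, written in integral form. -/
def IsTrajectory (k : ℝ → Evec d → ℝ) (t₀ : ℝ) (x₀ : Evec d) (u γ : ℝ → Evec d) : Prop :=
  ∀ t, t₀ ≤ t → γ t = x₀ + ∫ s in t₀..t, k s (γ s) • u s

/-- The set of nonnegative elapsed times at which a trajectory started at time `t₀`
lies on the boundary of `Ω`. -/
def exitSet (Ω : Set (Evec d)) (t₀ : ℝ) (γ : ℝ → Evec d) : Set ℝ :=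
  {τ : ℝ | 0 ≤ τ ∧ γ (t₀ + τ) ∈ frontier Ω}

/-- The exit time `τ^{t₀,x₀,u}` (with junk value `sInf ∅ = 0` if the trajectory never
reaches the boundary). -/
def exitTime (Ω : Set (Evec d)) (t₀ : ℝ) (γ : ℝ → Evec d) : ℝ :=
  sInf (exitSet Ω t₀ γ)

/-- The cost `τ^{t₀,x₀,u} + g(γ^{t₀,x₀,u}_τ)`. -/
def exitCost (Ω : Set (Evec d)) (g : Evec d → ℝ) (t₀ : ℝ) (γ : ℝ → Evec d) : ℝ :=
  exitTime Ω t₀ γ + g (γ (t₀ + exitTime Ω t₀ γ))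

/-- The set of costs achievable from `(t₀, x₀)` by admissible controls whose
trajectory reaches the boundary. -/
def costSet (Ω : Set (Evec d)) (k : ℝ → Evec d → ℝ) (g : Evec d → ℝ)
    (t₀ : ℝ) (x₀ : Evec d) : Set ℝ :=
  {r | ∃ u γ, IsControl u ∧ IsTrajectory k t₀ x₀ u γ ∧ (exitSet Ω t₀ γ).Nonempty ∧
    r = exitCost Ω g t₀ γ}

/-- The value function `φ(t, x)`. -/
def valueFun (Ω : Set (Evec d)) (k : ℝ → Evec d → ℝ) (g : Evec d → ℝ)
    (t : ℝ) (x : Evec d) : ℝ :=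
  sInf (costSet Ω k g t x)

/-- `u` (with associated trajectory `γ`) is an optimal control for `x₀` at time `t₀`. -/
def IsOptimal (Ω : Set (Evec d)) (k : ℝ → Evec d → ℝ) (g : Evec d → ℝ)
    (t₀ : ℝ) (x₀ : Evec d) (u γ : ℝ → Evec d) : Prop :=
  IsControl u ∧ IsTrajectory k t₀ x₀ u γ ∧ (exitSet Ω t₀ γ).Nonempty ∧
  IsLeast (costSet Ω k g t₀ x₀) (exitCost Ω g t₀ γ)

/-- The superdifferential `D⁺φ(t,x)` of a function `φ` of `(t,x)`:
`(h, p) ∈ D⁺φ(t,x)` iff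
`limsup_{(s,y)→(t,x)} (φ(s,y) − φ(t,x) − h(s−t) − p·(y−x))/|(s−t, y−x)| ≤ 0`. -/
def superDiff (φ : ℝ → Evec d → ℝ) (t : ℝ) (x : Evec d) : Set (ℝ × Evec d) :=
  {p | ∀ ε > (0 : ℝ), ∀ᶠ (q : ℝ × Evec d) in nhds (t, x),
    φ q.1 q.2 - φ t x - p.1 * (q.1 - t) - ⟪p.2, q.2 - x⟫ ≤ ε * ‖(q.1 - t, q.2 - x)‖}

theorem continuous_extend_speed {k : ℝ → Evec d → ℝ}
    (hk : ContinuousOn (fun p : ℝ × Evec d => k p.1 p.2) (Set.Ici 0 ×ˢ Set.univ)) :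
    Continuous fun p : ℝ × Evec d => k (max p.1 0) p.2 :=
  hk.comp_continuous (f := fun p : ℝ × Evec d => (max p.1 0, p.2)) (by fun_prop)
    fun p => ⟨le_max_right p.1 0, trivial⟩

theorem norm_speed_smul_le {k : ℝ → Evec d → ℝ} {kmin kmax : ℝ} (hkmin : 0 < kmin)
    (hkbdd : ∀ t x, 0 ≤ t → kmin ≤ k t x ∧ k t x ≤ kmax) {u : ℝ → Evec d} (hu : IsControl u)
    {s : ℝ} (hs : 0 ≤ s) {C : ℝ} {y : Evec d} (hC : k s y ≤ C) : ‖k s y • u s‖ ≤ C := by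
  have h := (hkbdd s y hs).1
  rw [norm_smul, Real.norm_of_nonneg (by linarith)]
  nlinarith [hu.2 s, norm_nonneg (u s)]

/-- The velocity of a trajectory is automatically integrable. -/
theorem IsTrajectory.intervalIntegrable {k : ℝ → Evec d → ℝ} {kmin kmax : ℝ}
    (hk : ContinuousOn (fun p : ℝ × Evec d => k p.1 p.2) (Set.Ici 0 ×ˢ Set.univ))
    (hkmin : 0 < kmin) (hkbdd : ∀ t x, 0 ≤ t → kmin ≤ k t x ∧ k t x ≤ kmax)
    {t : ℝ} (ht : 0 ≤ t) {x : Evec d} {u γ : ℝ → Evec d} (hu : IsControl u)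
    (hγ : IsTrajectory k t x u γ) {a b : ℝ} (ha : t ≤ a) (hb : t ≤ b) :
    IntervalIntegrable (fun s => k s (γ s) • u s) volume a b := by
  set f : ℝ → Evec d := fun s => k s (γ s) • u s with hf
  set A : Set ℝ := {b | t ≤ b ∧ IntervalIntegrable f volume t b} with hA
  have hbound : ∀ s, t ≤ s → ‖f s‖ ≤ kmax := fun s hs =>
    norm_speed_smul_le hkmin hkbdd hu (ht.trans hs) (hkbdd s _ (ht.trans hs)).2
  have hmono : ∀ p q, t ≤ p → p ≤ q → q ∈ A → p ∈ A := fun p q hp hpq hq =>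
    ⟨hp, hq.2.mono_set (by
      rw [uIcc_of_le hp, uIcc_of_le hq.1]; exact Icc_subset_Icc_right hpq)⟩
  have hAm : MeasurableSet A := by
    have : A.OrdConnected := ⟨fun p hp q hq r hr => hmono r q (hp.1.trans hr.1) hr.2 hq⟩
    exact this.measurableSet
  have hlip : LipschitzOnWith kmax.toNNReal γ A := by
    refine LipschitzOnWith.of_dist_le_mul fun p hp q hq => ?_
    have hkm : 0 ≤ kmax := (norm_nonneg _).trans (hbound t le_rfl)
    rw [Real.coe_toNNReal _ hkm, dist_eq_norm, hγ p hp.1, hγ q hq.1, add_sub_add_left_eq_sub,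
      intervalIntegral.integral_interval_sub_left hp.2 hq.2, Real.dist_eq]
    refine intervalIntegral.norm_integral_le_of_norm_le_const fun s hs => hbound s ?_
    exact (le_min hq.1 hp.1).trans hs.1.le
  have hγm : AEMeasurable γ (volume.restrict (Ici t)) := by
    have hU : Ici t ⊆ A ∪ (Ici t \ A) := by simp
    refine AEMeasurable.mono_measure ?_ (Measure.restrict_mono_set _ hU)
    rw [aemeasurable_union_iff]
    refine ⟨hlip.continuousOn.aemeasurable hAm, ?_⟩
    refine (aemeasurable_const (b := x)).congr ?_
    refine (ae_restrict_iff' (measurableSet_Ici.diff hAm)).2 (ae_of_all _ fun s hs => ?_)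
    have hni : ¬ IntervalIntegrable f volume t s := fun h => hs.2 ⟨hs.1, h⟩
    rw [hγ s hs.1, intervalIntegral.integral_undef hni, add_zero]
  have hfm : AEStronglyMeasurable f (volume.restrict (Ici t)) := by
    have h1 : AEMeasurable (fun s => k (max s 0) (γ s) • u s) (volume.restrict (Ici t)) :=
      ((continuous_extend_speed hk).measurable.comp_aemeasurable
        (aemeasurable_id.prodMk hγm)).smul hu.1.aemeasurable
    refine (h1.congr ?_).aestronglyMeasurable
    refine (ae_restrict_iff' measurableSet_Ici).2 (ae_of_all _ fun s hs => ?_)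
    simp only [hf, max_eq_left (ht.trans hs)]
  have hsub : uIoc a b ⊆ Ici t := fun s hs => (le_min ha hb).trans hs.1.le
  rw [intervalIntegrable_iff]
  refine IntegrableOn.of_bound (by simp [uIoc])
    (hfm.mono_measure (Measure.restrict_mono_set _ hsub)) kmax ?_
  exact (ae_restrict_iff' measurableSet_uIoc).2 (ae_of_all _ fun s hs => hbound s (hsub hs))

theorem IsTrajectory.sub_eq {k : ℝ → Evec d → ℝ} {kmin kmax : ℝ}
    (hk : ContinuousOn (fun p : ℝ × Evec d => k p.1 p.2) (Set.Ici 0 ×ˢ Set.univ))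
    (hkmin : 0 < kmin) (hkbdd : ∀ t x, 0 ≤ t → kmin ≤ k t x ∧ k t x ≤ kmax)
    {t : ℝ} (ht : 0 ≤ t) {x : Evec d} {u γ : ℝ → Evec d} (hu : IsControl u)
    (hγ : IsTrajectory k t x u γ) {a b : ℝ} (ha : t ≤ a) (hb : t ≤ b) :
    γ b - γ a = ∫ s in a..b, k s (γ s) • u s := by
  rw [hγ b hb, hγ a ha, add_sub_add_left_eq_sub, intervalIntegral.integral_interval_sub_left
    (hγ.intervalIntegrable hk hkmin hkbdd ht hu le_rfl hb)
    (hγ.intervalIntegrable hk hkmin hkbdd ht hu le_rfl ha)]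

theorem IsTrajectory.continuousOn {k : ℝ → Evec d → ℝ} {kmin kmax : ℝ}
    (hk : ContinuousOn (fun p : ℝ × Evec d => k p.1 p.2) (Set.Ici 0 ×ˢ Set.univ))
    (hkmin : 0 < kmin) (hkbdd : ∀ t x, 0 ≤ t → kmin ≤ k t x ∧ k t x ≤ kmax)
    {t : ℝ} (ht : 0 ≤ t) {x : Evec d} {u γ : ℝ → Evec d} (hu : IsControl u)
    (hγ : IsTrajectory k t x u γ) : ContinuousOn γ (Ici t) := by
  refine LipschitzOnWith.continuousOn (K := kmax.toNNReal)
    (LipschitzOnWith.of_dist_le_mul fun p hp q hq => ?_)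
  have hkm : 0 ≤ kmax := hkmin.le.trans ((hkbdd t x ht).1.trans (hkbdd t x ht).2)
  rw [Real.coe_toNNReal _ hkm, dist_eq_norm, hγ.sub_eq hk hkmin hkbdd ht hu hq hp, Real.dist_eq]
  refine intervalIntegral.norm_integral_le_of_norm_le_const fun s hs => ?_
  have hs' : 0 ≤ s := ht.trans ((le_min hq hp).trans hs.1.le)
  exact norm_speed_smul_le hkmin hkbdd hu hs' (hkbdd s _ hs').2

theorem exitTime_isLeast {Ω : Set (Evec d)} {t : ℝ} {γ : ℝ → Evec d}
    (hγ : ContinuousOn γ (Ici t)) (hne : (exitSet Ω t γ).Nonempty) :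
    IsLeast (exitSet Ω t γ) (exitTime Ω t γ) := by
  have hcl : IsClosed (exitSet Ω t γ) := by
    have hc : ContinuousOn (fun τ => γ (t + τ)) (Ici 0) :=
      hγ.comp (by fun_prop) fun τ hτ => by simpa using hτ
    exact hc.preimage_isClosed_of_isClosed isClosed_Ici isClosed_frontier
  exact hcl.isLeast_csInf hne ⟨0, fun _ h => h.1⟩

theorem exitCost_eq_of_isLeast {Ω : Set (Evec d)} {g : Evec d → ℝ} {t σ : ℝ} {γ : ℝ → Evec d}
    (h : IsLeast (exitSet Ω t γ) σ) : exitCost Ω g t γ = σ + g (γ (t + σ)) := by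
  rw [exitCost, exitTime, h.csInf_eq]

theorem costSet_bddBelow {Ω : Set (Evec d)} {k : ℝ → Evec d → ℝ} {g : Evec d → ℝ} {kmin kmax : ℝ}
    (hk : ContinuousOn (fun p : ℝ × Evec d => k p.1 p.2) (Set.Ici 0 ×ˢ Set.univ))
    (hkmin : 0 < kmin) (hkbdd : ∀ t x, 0 ≤ t → kmin ≤ k t x ∧ k t x ≤ kmax)
    (hg0 : ∀ x ∈ frontier Ω, 0 ≤ g x) {t : ℝ} (ht : 0 ≤ t) (x : Evec d) :
    BddBelow (costSet Ω k g t x) := by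
  refine ⟨0, ?_⟩
  rintro _ ⟨u, γ, hu, hγ, hne, rfl⟩
  have h := (exitTime_isLeast (hγ.continuousOn hk hkmin hkbdd ht hu) hne).1
  exact add_nonneg h.1 (hg0 _ h.2)

/-- Following an admissible arc that avoids the boundary for a time `h` before using a control
with cost `r` costs `h + r`. -/
theorem add_mem_costSet {Ω : Set (Evec d)} {k : ℝ → Evec d → ℝ} {g : Evec d → ℝ} {kmin kmax : ℝ}
    (hk : ContinuousOn (fun p : ℝ × Evec d => k p.1 p.2) (Set.Ici 0 ×ˢ Set.univ))
    (hkmin : 0 < kmin) (hkbdd : ∀ t x, 0 ≤ t → kmin ≤ k t x ∧ k t x ≤ kmax)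
    {t h : ℝ} (ht : 0 ≤ t) (hh : 0 ≤ h) {x : Evec d} {u γ : ℝ → Evec d} (hu : IsControl u)
    (hγ : ∀ s ∈ Icc t (t + h), γ s = x + ∫ r in t..s, k r (γ r) • u r)
    (hint : IntervalIntegrable (fun s => k s (γ s) • u s) volume t (t + h))
    (hfr : ∀ s ∈ Ico t (t + h), γ s ∉ frontier Ω)
    {r : ℝ} (hr : r ∈ costSet Ω k g (t + h) (γ (t + h))) :
    h + r ∈ costSet Ω k g t x := by
  obtain ⟨v, η, hv, hη, hne, rfl⟩ := hr
  have hth : 0 ≤ t + h := add_nonneg ht hh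
  set w : ℝ → Evec d := fun s => if s < t + h then u s else v s with hw
  set ζ : ℝ → Evec d := fun s => if s < t + h then γ s else η s with hζ
  have hcongr1 : ∀ s ∈ Icc t (t + h),
      ∫ r in t..s, k r (ζ r) • w r = ∫ r in t..s, k r (γ r) • u r := by
    intro s hs
    refine intervalIntegral.integral_congr_ae ?_
    have : ∀ᵐ r : ℝ, r ≠ t + h := by simp [ae_iff]
    filter_upwards [this] with r hr hrs
    rw [uIoc_of_le hs.1] at hrs
    have : r < t + h := lt_of_le_of_ne (hrs.2.trans hs.2) hr
    simp only [hζ, hw, if_pos this]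
  have hcongr2 : ∀ s, t + h ≤ s → EqOn (fun r => k r (ζ r) • w r) (fun r => k r (η r) • v r)
      (uIcc (t + h) s) := by
    intro s hs r hrs
    rw [uIcc_of_le hs] at hrs
    simp only [hζ, hw, if_neg hrs.1.not_gt]
  have hint1 : IntervalIntegrable (fun s => k s (ζ s) • w s) volume t (t + h) := by
    refine hint.congr_ae ((ae_restrict_iff' measurableSet_uIoc).2 ?_)
    have : ∀ᵐ r : ℝ, r ≠ t + h := by simp [ae_iff]
    filter_upwards [this] with r hr hrs
    rw [uIoc_of_le (by linarith)] at hrs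
    have : r < t + h := lt_of_le_of_ne hrs.2 hr
    simp only [hζ, hw, if_pos this]
  have hleast := exitTime_isLeast (hη.continuousOn hk hkmin hkbdd hth hv) hne
  set σ := exitTime Ω (t + h) η with hσ
  have hleast' : IsLeast (exitSet Ω t ζ) (h + σ) := by
    refine ⟨⟨add_nonneg hh hleast.1.1, ?_⟩, ?_⟩
    · have h1 : ¬ t + (h + σ) < t + h := by linarith [hleast.1.1]
      simp only [hζ, if_neg h1]
      rw [← add_assoc]
      exact hleast.1.2
    · rintro τ ⟨hτ, hτf⟩
      by_cases hlt : t + τ < t + h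
      · simp only [hζ, if_pos hlt] at hτf
        exact absurd hτf (hfr _ ⟨by linarith, hlt⟩)
      · simp only [hζ, if_neg hlt] at hτf
        have : σ ≤ τ - h := hleast.2 ⟨by linarith, by
          rwa [show t + h + (τ - h) = t + τ by ring]⟩
        linarith
  refine ⟨w, ζ, ⟨Measurable.ite measurableSet_Iio hu.1 hv.1, fun s => ?_⟩, fun s hs => ?_,
    ⟨_, hleast'.1⟩, ?_⟩
  · simp only [hw]; split_ifs
    exacts [hu.2 s, hv.2 s]
  · rcases lt_or_ge s (t + h) with hlt | hge
    · rw [hcongr1 s ⟨hs, hlt.le⟩, ← hγ s ⟨hs, hlt.le⟩]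
      simp only [hζ, if_pos hlt]
    · have hint2 : IntervalIntegrable (fun s => k s (ζ s) • w s) volume (t + h) s :=
        (hη.intervalIntegrable hk hkmin hkbdd hth hv le_rfl hge).congr
          ((hcongr2 s hge).symm.mono uIoc_subset_uIcc)
      rw [← intervalIntegral.integral_add_adjacent_intervals hint1 hint2,
        hcongr1 _ ⟨by linarith, le_rfl⟩, intervalIntegral.integral_congr (hcongr2 s hge), ← add_assoc,
        ← hγ _ ⟨by linarith, le_rfl⟩, ← hη s hge]
      simp only [hζ, if_neg hge.not_gt]
  · rw [exitCost_eq_of_isLeast hleast', exitCost_eq_of_isLeast hleast]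
    have h1 : ¬ t + (h + σ) < t + h := by linarith [hleast.1.1]
    simp only [hζ, if_neg h1]
    rw [add_assoc, add_assoc]

/-- A straight line of constant speed `c` is driven by an admissible control as long as `c` is
at most the maximal speed. -/
theorem exists_control_line {k : ℝ → Evec d → ℝ} {kmin kmax : ℝ}
    (hk : ContinuousOn (fun p : ℝ × Evec d => k p.1 p.2) (Set.Ici 0 ×ˢ Set.univ))
    (hkmin : 0 < kmin) (hkbdd : ∀ t x, 0 ≤ t → kmin ≤ k t x ∧ k t x ≤ kmax)
    {t c : ℝ} (hc : 0 ≤ c) (x v : Evec d) (hv : ‖v‖ ≤ 1) :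
    ∃ u, IsControl u ∧ ∀ s, 0 ≤ s → c ≤ k s (x + (c * (s - t)) • v) →
      k s (x + (c * (s - t)) • v) • u s = c • v := by
  set K : ℝ → ℝ := fun s => k (max s 0) (x + (c * (s - t)) • v) with hK
  have hKc : Continuous K := (continuous_extend_speed hk).comp
      (by fun_prop : Continuous fun s : ℝ => (s, x + (c * (s - t)) • v))
  have hKpos : ∀ s, 0 < K s := fun s => hkmin.trans_le (hkbdd _ _ (le_max_right _ _)).1
  refine ⟨fun s => min 1 (c / K s) • v, ⟨?_, fun s => ?_⟩, fun s hs hcs => ?_⟩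
  · exact ((measurable_const.min (measurable_const.div hKc.measurable))).smul measurable_const
  · have h0 : 0 ≤ min 1 (c / K s) := le_min zero_le_one (div_nonneg hc (hKpos s).le)
    rw [norm_smul, Real.norm_of_nonneg h0]
    exact mul_le_one₀ (min_le_left _ _) (norm_nonneg _) hv
  · have hKs : k s (x + (c * (s - t)) • v) = K s := by simp only [hK, max_eq_left hs]
    rw [hKs] at hcs ⊢
    have h1 : min 1 (c / K s) = c / K s := min_eq_right ((div_le_one (hKpos s)).2 hcs)
    simp only [h1, smul_smul, mul_div_cancel₀ _ (hKpos s).ne']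

theorem line_eq_integral {t c s : ℝ} {x v : Evec d} {f : ℝ → Evec d}
    (hf : EqOn f (fun _ => c • v) (uIcc t s)) :
    x + (c * (s - t)) • v = x + ∫ r in t..s, f r := by
  rw [intervalIntegral.integral_congr hf, intervalIntegral.integral_const, smul_smul, mul_comm]

theorem costSet_nonempty {Ω : Set (Evec d)} {k : ℝ → Evec d → ℝ} {g : Evec d → ℝ} {kmin kmax : ℝ}
    (hk : ContinuousOn (fun p : ℝ × Evec d => k p.1 p.2) (Set.Ici 0 ×ˢ Set.univ))
    (hkmin : 0 < kmin) (hkbdd : ∀ t x, 0 ≤ t → kmin ≤ k t x ∧ k t x ≤ kmax)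
    (hΩ : (frontier Ω).Nonempty) {t : ℝ} (ht : 0 ≤ t) (x : Evec d) :
    (costSet Ω k g t x).Nonempty := by
  obtain ⟨z, hz⟩ := hΩ
  set v : Evec d := ‖z - x‖⁻¹ • (z - x) with hv
  have hv1 : ‖v‖ ≤ 1 := by
    rw [hv, norm_smul, norm_inv, norm_norm]
    exact inv_mul_le_one
  have hzv : ‖z - x‖ • v = z - x := by
    by_cases h : z - x = 0
    · simp [hv, h]
    · rw [hv, smul_smul, mul_inv_cancel₀ (norm_ne_zero_iff.2 h), one_smul]
  obtain ⟨u, hu, hline⟩ := exists_control_line (t := t) hk hkmin hkbdd hkmin.le x v hv1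
  refine ⟨_, u, fun s => x + (kmin * (s - t)) • v, hu, fun s hs => ?_,
    ⟨‖z - x‖ / kmin, by positivity, ?_⟩, rfl⟩
  · refine line_eq_integral fun r hr => ?_
    rw [uIcc_of_le hs] at hr
    have hr0 := ht.trans hr.1
    exact hline r hr0 (hkbdd _ _ hr0).1
  · have : kmin * (t + ‖z - x‖ / kmin - t) = ‖z - x‖ := by field_simp; ring
    simp only [this, hzv, add_sub_cancel]
    exact hz

theorem valueFun_along_optimal {Ω : Set (Evec d)} {k : ℝ → Evec d → ℝ} {g : Evec d → ℝ}
    {kmin kmax : ℝ}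
    (hk : ContinuousOn (fun p : ℝ × Evec d => k p.1 p.2) (Set.Ici 0 ×ˢ Set.univ))
    (hkmin : 0 < kmin) (hkbdd : ∀ t x, 0 ≤ t → kmin ≤ k t x ∧ k t x ≤ kmax)
    {t₀ : ℝ} (ht₀ : 0 ≤ t₀) {x₀ : Evec d} {u γ : ℝ → Evec d}
    (hopt : IsOptimal Ω k g t₀ x₀ u γ) {t : ℝ} (ht : t ∈ Ico t₀ (t₀ + exitTime Ω t₀ γ)) :
    valueFun Ω k g t (γ t) = exitCost Ω g t₀ γ - (t - t₀) := by
  obtain ⟨hu, hγ, hne, -, hmin⟩ := hopt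
  have hleast := exitTime_isLeast (hγ.continuousOn hk hkmin hkbdd ht₀ hu) hne
  have hleast' : IsLeast (exitSet Ω t γ) (exitTime Ω t₀ γ - (t - t₀)) := by
    refine ⟨⟨by linarith [ht.2], ?_⟩, ?_⟩
    · convert hleast.1.2 using 2; ring
    · rintro τ ⟨hτ, hτf⟩
      have : exitTime Ω t₀ γ ≤ τ + (t - t₀) := hleast.2 ⟨by linarith [ht.1], by
        convert hτf using 2; ring⟩
      linarith
  refine IsLeast.csInf_eq ⟨⟨u, γ, hu, fun s hs => ?_, ⟨_, hleast'.1⟩, ?_⟩, fun r hr => ?_⟩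
  · rw [← hγ.sub_eq hk hkmin hkbdd ht₀ hu ht.1 (ht.1.trans hs), add_sub_cancel]
  · rw [exitCost_eq_of_isLeast hleast', exitCost]
    rw [show t + (exitTime Ω t₀ γ - (t - t₀)) = t₀ + exitTime Ω t₀ γ by ring]
    ring
  · have heq : t₀ + (t - t₀) = t := by ring
    have := hmin (add_mem_costSet (h := t - t₀) hk hkmin hkbdd ht₀ (by linarith [ht.1]) hu
      (fun s hs => hγ s hs.1)
      (hγ.intervalIntegrable hk hkmin hkbdd ht₀ hu le_rfl (by linarith [ht.1]))
      (fun s hs hsf => ?_) (by rwa [heq]))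
    · linarith
    · have := hleast.2 (show s - t₀ ∈ exitSet Ω t₀ γ from
        ⟨by linarith [hs.1], by rwa [add_sub_cancel]⟩)
      linarith [hs.2, ht.2]

theorem valueFun_le_add_line {Ω : Set (Evec d)} {k : ℝ → Evec d → ℝ} {g : Evec d → ℝ}
    {kmin kmax : ℝ}
    (hk : ContinuousOn (fun p : ℝ × Evec d => k p.1 p.2) (Set.Ici 0 ×ˢ Set.univ))
    (hkmin : 0 < kmin) (hkbdd : ∀ t x, 0 ≤ t → kmin ≤ k t x ∧ k t x ≤ kmax)
    (hg0 : ∀ x ∈ frontier Ω, 0 ≤ g x) (hΩ : (frontier Ω).Nonempty)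
    {t h c : ℝ} (ht : 0 ≤ t) (hh : 0 ≤ h) (hc : 0 ≤ c) {x v : Evec d} (hv : ‖v‖ ≤ 1)
    (hline : ∀ s ∈ Icc t (t + h), c ≤ k s (x + (c * (s - t)) • v) ∧
      x + (c * (s - t)) • v ∉ frontier Ω) :
    valueFun Ω k g t x ≤ h + valueFun Ω k g (t + h) (x + (c * h) • v) := by
  obtain ⟨u, hu, hux⟩ := exists_control_line (t := t) hk hkmin hkbdd hc x v hv
  have heq : ∀ s ∈ Icc t (t + h), EqOn (fun r => k r (x + (c * (r - t)) • v) • u r)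
      (fun _ => c • v) (uIcc t s) := by
    intro s hs r hr
    rw [uIcc_of_le hs.1] at hr
    exact hux r (ht.trans hr.1) (hline r ⟨hr.1, hr.2.trans hs.2⟩).1
  have hth : t + h ∈ Icc t (t + h) := ⟨by linarith, le_rfl⟩
  rw [← sub_le_iff_le_add']
  refine le_csInf (costSet_nonempty hk hkmin hkbdd hΩ (add_nonneg ht hh) _) fun r hr => ?_
  rw [sub_le_iff_le_add']
  refine csInf_le (costSet_bddBelow hk hkmin hkbdd hg0 ht x) ?_
  refine add_mem_costSet hk hkmin hkbdd ht hh (γ := fun s => x + (c * (s - t)) • v) hu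
    (fun s hs => line_eq_integral (heq s hs))
    ((intervalIntegrable_const (c := c • v)).congr ((heq _ hth).symm.mono uIoc_subset_uIcc))
    (fun s hs => (hline s ⟨hs.1, hs.2.le⟩).2) ?_
  simpa using hr

theorem superDiff_valueFun_le {Ω : Set (Evec d)} {k : ℝ → Evec d → ℝ} {g : Evec d → ℝ}
    {kmin kmax : ℝ}
    (hk : ContinuousOn (fun p : ℝ × Evec d => k p.1 p.2) (Set.Ici 0 ×ˢ Set.univ))
    (hkmin : 0 < kmin) (hkbdd : ∀ t x, 0 ≤ t → kmin ≤ k t x ∧ k t x ≤ kmax)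
    (hg0 : ∀ x ∈ frontier Ω, 0 ≤ g x) (hΩ : (frontier Ω).Nonempty)
    {t : ℝ} (ht : 0 ≤ t) {x : Evec d} (hx : x ∉ frontier Ω) {p : ℝ × Evec d}
    (hp : p ∈ superDiff (valueFun Ω k g) t x) : -p.1 + k t x * ‖p.2‖ - 1 ≤ 0 := by
  have hK : 0 < k t x := hkmin.trans_le (hkbdd t x ht).1
  have key : ∀ c ∈ Ioo 0 (k t x), ∀ ε > 0, -p.1 + c * ‖p.2‖ - 1 ≤ ε * (1 + c) := by
    rintro c ⟨hc0, hcK⟩ ε hε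
    set v : Evec d := -(‖p.2‖⁻¹ • p.2) with hv
    have hv1 : ‖v‖ ≤ 1 := by
      rw [hv, norm_neg, norm_smul, norm_inv, norm_norm]
      exact inv_mul_le_one
    have hpv : ⟪p.2, v⟫ = -‖p.2‖ := by
      rw [hv, inner_neg_right, inner_smul_right, real_inner_self_eq_norm_sq]
      by_cases h : ‖p.2‖ = 0
      · simp [h]
      · field_simp
    have hcont : Continuous fun s : ℝ => (s, x + (c * (s - t)) • v) := by fun_prop
    have htend : Tendsto (fun s : ℝ => (s, x + (c * (s - t)) • v)) (𝓝 t) (𝓝 (t, x)) := by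
      simpa using hcont.tendsto t
    have e1 : ∀ᶠ s in 𝓝 t, c < k (max s 0) (x + (c * (s - t)) • v) := by
      have : Tendsto (fun q : ℝ × Evec d => k (max q.1 0) q.2) (𝓝 (t, x)) (𝓝 (k t x)) := by
        simpa [max_eq_left ht] using (continuous_extend_speed hk).tendsto (t, x)
      exact (this.comp htend).eventually (lt_mem_nhds hcK)
    have e2 : ∀ᶠ s in 𝓝 t, x + (c * (s - t)) • v ∉ frontier Ω :=
      (continuous_snd.tendsto (t, x) |>.comp htend).eventually
        (isClosed_frontier.isOpen_compl.mem_nhds hx)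
    obtain ⟨δ, hδ, hball⟩ := Metric.eventually_nhds_iff.1
      ((e1.and e2).and (htend.eventually (hp ε hε)))
    have hd : ∀ s ∈ Icc t (t + δ / 2), dist s t < δ := fun s hs => by
      rw [Real.dist_eq, abs_of_nonneg (by linarith [hs.1])]; linarith [hs.2]
    have hval := valueFun_le_add_line (g := g) (h := δ / 2) hk hkmin hkbdd hg0 hΩ ht
      (by positivity) hc0.le hv1 fun s hs => by
        have h := (hball (hd s hs)).1
        rw [max_eq_left (ht.trans hs.1)] at h
        exact ⟨h.1.le, h.2⟩
    have hsup := (hball (hd (t + δ / 2) ⟨by linarith, le_rfl⟩)).2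
    simp only [add_sub_cancel_left, inner_smul_right, hpv] at hsup
    have hnorm : ‖(δ / 2, (c * (δ / 2)) • v)‖ ≤ δ / 2 * (1 + c) := by
      rw [Prod.norm_def]
      have h2 : ‖(c * (δ / 2)) • v‖ ≤ c * (δ / 2) := by
        rw [norm_smul, Real.norm_of_nonneg (by positivity)]
        exact mul_le_of_le_one_right (by positivity) hv1
      have h3 : ‖δ / 2‖ = δ / 2 := Real.norm_of_nonneg (by positivity)
      refine max_le ?_ ?_
      · simp only [h3]; nlinarith
      · simp only; nlinarith
    have h4 := mul_le_mul_of_nonneg_left hnorm hε.le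
    refine le_of_mul_le_mul_left (a := δ / 2) ?_ (by positivity)
    nlinarith
  have hlim : ∀ c ∈ Ioo 0 (k t x), -p.1 + c * ‖p.2‖ - 1 ≤ 0 := by
    intro c hc
    refine le_of_forall_pos_le_add fun η hη => ?_
    have h1 : 0 < 1 + c := by linarith [hc.1]
    have := key c hc (η / (1 + c)) (by positivity)
    rw [div_mul_cancel₀ _ h1.ne'] at this
    linarith
  have hcl : k t x ∈ closure (Ioo 0 (k t x)) := by
    rw [closure_Ioo hK.ne]; exact ⟨hK.le, le_rfl⟩
  have hclosed : IsClosed {c : ℝ | -p.1 + c * ‖p.2‖ - 1 ≤ 0} :=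
    isClosed_le (by fun_prop) continuous_const
  exact closure_minimal hlim hclosed hcl

theorem le_superDiff_valueFun_along_optimal {Ω : Set (Evec d)} {k : ℝ → Evec d → ℝ}
    {g : Evec d → ℝ} {kmin kmax : ℝ}
    (hk : ContinuousOn (fun p : ℝ × Evec d => k p.1 p.2) (Set.Ici 0 ×ˢ Set.univ))
    (hkmin : 0 < kmin) (hkbdd : ∀ t x, 0 ≤ t → kmin ≤ k t x ∧ k t x ≤ kmax)
    {t₀ : ℝ} (ht₀ : 0 ≤ t₀) {x₀ : Evec d} {u γ : ℝ → Evec d}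
    (hopt : IsOptimal Ω k g t₀ x₀ u γ) {t : ℝ} (ht : t ∈ Ioo t₀ (t₀ + exitTime Ω t₀ γ))
    {p : ℝ × Evec d} (hp : p ∈ superDiff (valueFun Ω k g) t (γ t)) :
    0 ≤ -p.1 + k t (γ t) * ‖p.2‖ - 1 := by
  have ht0 : 0 ≤ t := ht₀.trans ht.1.le
  obtain ⟨hu, hγ, -⟩ := id hopt
  have hK : 0 < k t (γ t) := hkmin.trans_le (hkbdd t _ ht0).1
  have hγc : ContinuousAt γ t :=
    (hγ.continuousOn hk hkmin hkbdd ht₀ hu).continuousAt (Ici_mem_nhds ht.1)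
  have htend : Tendsto (fun s => (s, γ s)) (𝓝 t) (𝓝 (t, γ t)) :=
    continuousAt_id.prodMk hγc
  have key : ∀ c ∈ Ioi (k t (γ t)), ∀ ε > 0, 1 + p.1 - c * ‖p.2‖ ≤ ε * (1 + c) := by
    intro c hc ε hε
    have hc0 : 0 < c := hK.trans hc
    have e1 : ∀ᶠ s in 𝓝 t, k (max s 0) (γ s) < c := by
      have : Tendsto (fun q : ℝ × Evec d => k (max q.1 0) q.2) (𝓝 (t, γ t))
          (𝓝 (k t (γ t))) := by
        simpa [max_eq_left ht0] using (continuous_extend_speed hk).tendsto (t, γ t)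
      exact (this.comp htend).eventually (gt_mem_nhds hc)
    obtain ⟨δ, hδ, hball⟩ := Metric.eventually_nhds_iff.1
      ((e1.and (lt_mem_nhds ht.1)).and (htend.eventually (hp ε hε)))
    set h := δ / 2 with hh
    have hh0 : 0 < h := by positivity
    have hd : ∀ s ∈ Icc (t - h) t, dist s t < δ := fun s hs => by
      rw [Real.dist_eq, abs_sub_comm, abs_of_nonneg (by linarith [hs.2])]; linarith [hs.1]
    have hth : t - h ∈ Icc (t - h) t := ⟨le_rfl, by linarith⟩
    have ht' : t₀ < t - h := (hball (hd _ hth)).1.2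
    have hsup := (hball (hd _ hth)).2
    have hnear : ‖γ (t - h) - γ t‖ ≤ c * h := by
      rw [hγ.sub_eq hk hkmin hkbdd ht₀ hu ht.1.le ht'.le]
      have := intervalIntegral.norm_integral_le_of_norm_le_const
        (f := fun s => k s (γ s) • u s) (a := t) (b := t - h) (C := c) fun s hs => by
          rw [uIoc_of_ge (by linarith)] at hs
          have hs0 : 0 ≤ s := ht₀.trans (ht'.le.trans hs.1.le)
          have h1 := (hball (hd s ⟨hs.1.le, hs.2⟩)).1.1
          rw [max_eq_left hs0] at h1
          exact norm_speed_smul_le hkmin hkbdd hu hs0 h1.le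
      rwa [sub_sub_cancel_left, abs_neg, abs_of_pos hh0] at this
    have v1 := valueFun_along_optimal hk hkmin hkbdd ht₀ hopt ⟨ht.1.le, ht.2⟩
    have v2 := valueFun_along_optimal hk hkmin hkbdd ht₀ hopt (t := t - h)
      ⟨ht'.le, by linarith [ht.2]⟩
    simp only [v1, v2, sub_sub_cancel_left] at hsup
    have hin : ⟪p.2, γ (t - h) - γ t⟫ ≤ ‖p.2‖ * (c * h) :=
      (real_inner_le_norm _ _).trans (mul_le_mul_of_nonneg_left hnear (norm_nonneg _))
    have hnorm : ‖(-h, γ (t - h) - γ t)‖ ≤ h * (1 + c) := by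
      rw [Prod.norm_def]
      have h3 : ‖-h‖ = h := by rw [norm_neg, Real.norm_of_nonneg hh0.le]
      refine max_le ?_ ?_
      · simp only [h3]; nlinarith
      · simp only; nlinarith
    have h4 := mul_le_mul_of_nonneg_left hnorm hε.le
    refine le_of_mul_le_mul_left (a := h) ?_ hh0
    nlinarith
  have hlim : ∀ c ∈ Ioi (k t (γ t)), 0 ≤ -p.1 + c * ‖p.2‖ - 1 := by
    intro c hc
    refine le_of_forall_pos_le_add fun η hη => ?_
    have h1 : 0 < 1 + c := by linarith [hK.trans hc]
    have := key c hc (η / (1 + c)) (by positivity)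
    rw [div_mul_cancel₀ _ h1.ne'] at this
    linarith
  have hcl : k t (γ t) ∈ closure (Ioi (k t (γ t))) := by simp
  have hclosed : IsClosed {c : ℝ | 0 ≤ -p.1 + c * ‖p.2‖ - 1} :=
    isClosed_le continuous_const (by fun_prop)
  exact closure_minimal hlim hclosed hcl

/-- Along an optimal trajectory, away from the endpoints, every element of
the superdifferential of the value function satisfies the Hamilton–Jacobi equation. -/
theorem superdifferential_hamilton_jacobi_on_optimal_trajectory
    (Ω : Set (Evec d)) (hΩcomp : IsCompact Ω) (hΩreg : Ω = closure (interior Ω))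
    (hΩne : (interior Ω).Nonempty)
    (k : ℝ → Evec d → ℝ) (kmin kmax L₁ : ℝ)
    (hkcont : ContinuousOn (fun p : ℝ × Evec d => k p.1 p.2) (Set.Ici 0 ×ˢ Set.univ))
    (hkmin : 0 < kmin)
    (hkbdd : ∀ t x, 0 ≤ t → kmin ≤ k t x ∧ k t x ≤ kmax)
    (hklip : ∀ t, 0 ≤ t → ∀ x₁ x₂ : Evec d, |k t x₁ - k t x₂| ≤ L₁ * ‖x₁ - x₂‖)
    (g : Evec d → ℝ) (hgcont : ContinuousOn g (frontier Ω))
    (hg0 : ∀ x ∈ frontier Ω, 0 ≤ g x)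
    (lam : ℝ) (hlam : 0 < lam) (hlamk : lam < 1 / kmax)
    (hglip : ∀ x ∈ frontier Ω, ∀ y ∈ frontier Ω, |g x - g y| ≤ lam * ‖x - y‖)
    (t₀ : ℝ) (ht₀ : 0 ≤ t₀) (x₀ : Evec d) (hx₀ : x₀ ∈ Ω)
    (u γ : ℝ → Evec d) (hopt : IsOptimal Ω k g t₀ x₀ u γ) :
    ∀ t ∈ Set.Ioo t₀ (t₀ + exitTime Ω t₀ γ),
      ∀ p ∈ superDiff (valueFun Ω k g) t (γ t),
        -p.1 + k t (γ t) * ‖p.2‖ - 1 = 0 := by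
  intro t ht p hp
  obtain ⟨hu, hγ, hne, -⟩ := id hopt
  have hleast := exitTime_isLeast (hγ.continuousOn hkcont hkmin hkbdd ht₀ hu) hne
  have hx : γ t ∉ frontier Ω := fun h => by
    have := hleast.2 (show t - t₀ ∈ exitSet Ω t₀ γ from
      ⟨by linarith [ht.1], by rwa [add_sub_cancel]⟩)
    linarith [ht.2]
  exact le_antisymm
    (superDiff_valueFun_le hkcont hkmin hkbdd hg0 ⟨_, hleast.1.2⟩ (ht₀.trans ht.1.le) hx hp)
    (le_superDiff_valueFun_along_optimal hkcont hkmin hkbdd ht₀ hopt ht hp)
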